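/- Let E be a regular Courant algebroid and let Ψ₁, Ψ₂ be two dissections of E, with associated naive 3-cocycles C_{Ψ₁} and C_{Ψ₂}. Then C_{Ψ₁} − C_{Ψ₂} = d̆φ for some naive 2-cochain φ; consequently the cohomology class [C_Ψ] ∈ H³_naive(E) is independent of the chosen dissection Ψ (it is the characteristic class of E). -/

import Mathlib

/-! # Statement 5
For two dissections `Ψ₁, Ψ₂` of a regular Courant algebroid `E`, the associated naive
3-cocycles differ by a naive coboundary; hence the characteristic class
`[C_Ψ] ∈ H³_naive(E)` does not depend on the dissection.

Algebraic model: `A` plays the role of `C^∞(M)`, vector fields are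
`Derivation ℝ A A`, and `E` is the `A`-module of sections. -/

/-- A Courant algebroid (in algebraic form). -/
structure CourantAlgebroid (A : Type) [CommRing A] [Algebra ℝ A]
    (E : Type) [AddCommGroup E] [Module A E] [Module ℝ E] [IsScalarTower ℝ A E] where
  /-- the pseudo-metric `⟨-,-⟩` -/
  ip : E →ₗ[A] E →ₗ[A] A
  /-- the anchor `ρ` -/
  rho : E →ₗ[A] Derivation ℝ A A
  /-- the Dorfman bracket `∘` (ℝ-bilinear) -/
  dorf : E →ₗ[ℝ] E →ₗ[ℝ] E
  /-- the map `𝒟 : C^∞(M) → Γ(E)` -/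
  Dmap : A → E
  ip_symm : ∀ e₁ e₂, ip e₁ e₂ = ip e₂ e₁
  /-- fiberwise nondegeneracy of the pseudo-metric: `Ξ : E → E*` is bijective -/
  ip_nondeg : Function.Bijective fun e => ip e
  /-- `⟨𝒟f, e⟩ = ½ ρ(e) f` -/
  ip_D : ∀ (f : A) (e : E), (2 : A) * ip (Dmap f) e = rho e f
  /-- `ρ ∘ 𝒟 = 0` -/
  rho_D : ∀ f : A, rho (Dmap f) = 0
  dorf_jacobi : ∀ e₁ e₂ e₃,
    dorf e₁ (dorf e₂ e₃) = dorf (dorf e₁ e₂) e₃ + dorf e₂ (dorf e₁ e₃)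
  rho_dorf : ∀ e₁ e₂, rho (dorf e₁ e₂) = ⁅rho e₁, rho e₂⁆
  dorf_leibniz : ∀ (e₁ : E) (f : A) (e₂ : E),
    dorf e₁ (f • e₂) = rho e₁ f • e₂ + f • dorf e₁ e₂
  dorf_sym : ∀ e₁ e₂, dorf e₁ e₂ + dorf e₂ e₁ = (2 : ℝ) • Dmap (ip e₁ e₂)
  dorf_D : ∀ (f : A) (e : E), dorf (Dmap f) e = 0
  rho_ip : ∀ e₁ e₂ e₃,
    rho e₁ (ip e₂ e₃) = ip (dorf e₁ e₂) e₃ + ip e₂ (dorf e₁ e₃)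

namespace CourantAlgebroid

variable {A : Type} [CommRing A] [Algebra ℝ A]
variable {E : Type} [AddCommGroup E] [Module A E] [Module ℝ E] [IsScalarTower ℝ A E]
variable (ca : CourantAlgebroid A E)

/-- `(ker ρ)⊥`, the subbundle of `E` orthogonal to `ker ρ` w.r.t. the pseudo-metric. -/
def perp : Submodule A E where
  carrier := {e | ∀ k ∈ LinearMap.ker ca.rho, ca.ip e k = 0}
  add_mem' := by
    intro a b ha hb k hk
    simp [map_add, ha k hk, hb k hk]
  zero_mem' := by intro k hk; simp
  smul_mem' := by
    intro c x hx k hk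
    simp [map_smul, hx k hk]

/-- Regularity (constant rank of the anchor), expressed by the splitting of the two
canonical short exact sequences `0 → ker ρ → E → F → 0` and
`0 → (ker ρ)⊥ → ker ρ → 𝒢 → 0`. -/
def IsRegular : Prop :=
  (∃ lam : ↥(LinearMap.range ca.rho) →ₗ[A] E, ∀ x, ca.rho (lam x) = ↑x) ∧
  (∃ sig : (↥(LinearMap.ker ca.rho) ⧸
        (ca.perp.comap (LinearMap.ker ca.rho).subtype)) →ₗ[A] ↥(LinearMap.ker ca.rho),
      ∀ g, (ca.perp.comap (LinearMap.ker ca.rho).subtype).mkQ (sig g) = g)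

lemma dorf_mem_ker {r s : E} (hr : r ∈ LinearMap.ker ca.rho)
    (hs : s ∈ LinearMap.ker ca.rho) : ca.dorf r s ∈ LinearMap.ker ca.rho := by
  rw [LinearMap.mem_ker] at *
  rw [ca.rho_dorf, hr, hs, zero_lie]

lemma dorf_ker_left_mem_ker (e : E) {r : E} (hr : r ∈ LinearMap.ker ca.rho) :
    ca.dorf e r ∈ LinearMap.ker ca.rho := by
  rw [LinearMap.mem_ker] at *
  rw [ca.rho_dorf, hr, lie_zero]

/-- sections of `ker ρ` -/
abbrev Ker := ↥(LinearMap.ker ca.rho)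

/-- `(ker ρ)⊥` viewed inside `ker ρ` -/
abbrev perp' : Submodule A ca.Ker := ca.perp.comap (LinearMap.ker ca.rho).subtype

/-- `𝒢 := ker ρ/(ker ρ)⊥` -/
abbrev Gq := ca.Ker ⧸ ca.perp'

/-- the projection `π : ker ρ → 𝒢` -/
abbrev piG : ca.Ker →ₗ[A] ca.Gq := ca.perp'.mkQ

/-- the ample quotient `𝒜_E := E/(ker ρ)⊥` -/
abbrev Ample := E ⧸ ca.perp

/-- the projection `q : E → 𝒜_E` -/
abbrev qA : E →ₗ[A] ca.Ample := ca.perp.mkQ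

/-- Dorfman bracket of two sections of `ker ρ`, viewed in `ker ρ`. -/
def dorfK (r s : ca.Ker) : ca.Ker := ⟨ca.dorf ↑r ↑s, ca.dorf_mem_ker r.2 s.2⟩

/-- Dorfman bracket of a section of `E` with a section of `ker ρ`, viewed in `ker ρ`. -/
def dorfEK (e : E) (r : ca.Ker) : ca.Ker := ⟨ca.dorf e ↑r, ca.dorf_ker_left_mem_ker e r.2⟩

end CourantAlgebroid

section CE
variable {V A : Type} [CommRing A]

/-- differential of a `1`-form -/
def dCE1 (act : V → A → A) (bk : V → V → V) (ω : V → A) (x₀ x₁ : V) : A :=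
  act x₀ (ω x₁) - act x₁ (ω x₀) - ω (bk x₀ x₁)

/-- differential of a `2`-form -/
def dCE2 (act : V → A → A) (bk : V → V → V) (ω : V → V → A) (x₀ x₁ x₂ : V) : A :=
  act x₀ (ω x₁ x₂) - act x₁ (ω x₀ x₂) + act x₂ (ω x₀ x₁)
    - ω (bk x₀ x₁) x₂ + ω (bk x₀ x₂) x₁ - ω (bk x₁ x₂) x₀

/-- differential of a `3`-form -/
def dCE3 (act : V → A → A) (bk : V → V → V) (ω : V → V → V → A)
    (x₀ x₁ x₂ x₃ : V) : A :=
  act x₀ (ω x₁ x₂ x₃) - act x₁ (ω x₀ x₂ x₃) + act x₂ (ω x₀ x₁ x₃)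
    - act x₃ (ω x₀ x₁ x₂)
    - ω (bk x₀ x₁) x₂ x₃ + ω (bk x₀ x₂) x₁ x₃ - ω (bk x₀ x₃) x₁ x₂
    - ω (bk x₁ x₂) x₀ x₃ + ω (bk x₁ x₃) x₀ x₂ - ω (bk x₂ x₃) x₀ x₁

/-- differential of a `4`-form -/
def dCE4 (act : V → A → A) (bk : V → V → V) (ω : V → V → V → V → A)
    (x₀ x₁ x₂ x₃ x₄ : V) : A :=
  act x₀ (ω x₁ x₂ x₃ x₄) - act x₁ (ω x₀ x₂ x₃ x₄) + act x₂ (ω x₀ x₁ x₃ x₄)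
    - act x₃ (ω x₀ x₁ x₂ x₄) + act x₄ (ω x₀ x₁ x₂ x₃)
    - ω (bk x₀ x₁) x₂ x₃ x₄ + ω (bk x₀ x₂) x₁ x₃ x₄ - ω (bk x₀ x₃) x₁ x₂ x₄
    + ω (bk x₀ x₄) x₁ x₂ x₃
    - ω (bk x₁ x₂) x₀ x₃ x₄ + ω (bk x₁ x₃) x₀ x₂ x₄ - ω (bk x₁ x₄) x₀ x₂ x₃
    - ω (bk x₂ x₃) x₀ x₁ x₄ + ω (bk x₂ x₄) x₀ x₁ x₃
    - ω (bk x₃ x₄) x₀ x₁ x₂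

end CE

variable {A : Type} [CommRing A] [Algebra ℝ A]
variable {E : Type} [AddCommGroup E] [Module A E] [Module ℝ E] [IsScalarTower ℝ A E]

/-- The Courant bracket (skew-symmetrization of the Dorfman bracket). -/
noncomputable def courantBk (ca : CourantAlgebroid A E) (e₁ e₂ : E) : E :=
  (2:ℝ)⁻¹ • (ca.dorf e₁ e₂ - ca.dorf e₂ e₁)

section Diss
variable {G : Type} [AddCommGroup G] [Module A G] [Module ℝ G] [IsScalarTower ℝ A G]

/-- A dissection of a regular Courant algebroid: an isomorphism of vector bundles
`Ψ : F*⊕𝒢⊕F → E` compatible with the pseudo-metrics; it transports the Courant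
structure to a standard one (anchor the projection to `F`, pseudo-metric the standard
one, 𝒢-component of the Dorfman bracket of sections of 𝒢 the fiberwise bracket). -/
structure Dissection (lG : G →ₗ[A] G →ₗ[A] G) (ipG : G →ₗ[A] G →ₗ[A] A)
    (ca : CourantAlgebroid A E) where
  toEquiv : (Module.Dual A ↥(LinearMap.range ca.rho) × G ×
      ↥(LinearMap.range ca.rho)) ≃ₗ[A] E
  metric : ∀ p q, ca.ip (toEquiv p) (toEquiv q) =
    (2:ℝ)⁻¹ • p.1 q.2.2 + (2:ℝ)⁻¹ • q.1 p.2.2 + ipG p.2.1 q.2.1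
  anchor : ∀ p, ca.rho (toEquiv p) = ↑p.2.2
  gbracket : ∀ r s : G,
    (toEquiv.symm (ca.dorf (toEquiv (0, r, 0)) (toEquiv (0, s, 0)))).2.1 = lG r s

variable {lG : G →ₗ[A] G →ₗ[A] G} {ipG : G →ₗ[A] G →ₗ[A] A}
variable {ca : CourantAlgebroid A E}

/-- The curvature-type map `R(x,y) = pr_𝒢(x∘y)` induced by a dissection. -/
def Dissection.Rmap (d : Dissection lG ipG ca) (x y : ↥(LinearMap.range ca.rho)) : G :=
  (d.toEquiv.symm (ca.dorf (d.toEquiv (0, 0, x)) (d.toEquiv (0, 0, y)))).2.1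

/-- The 3-form `ℋ(x,y,z) = ⟨pr_{F*}(x∘y),z⟩` induced by a dissection. -/
def Dissection.Hmap (d : Dissection lG ipG ca)
    (x y z : ↥(LinearMap.range ca.rho)) : A :=
  (d.toEquiv.symm (ca.dorf (d.toEquiv (0, 0, x)) (d.toEquiv (0, 0, y)))).1 z

/-- The naive 3-cocycle `C_Ψ` associated to a dissection `Ψ`, given in the splitting by
`C_Ψ(ξ+r+x, η+s+y, ζ+t+z)
  = ⟨R(x,y),t⟩ + ⟨R(y,z),r⟩ + ⟨R(z,x),s⟩ − ⟨[r,s]_𝒢,t⟩ + ℋ(x,y,z)`. -/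
def Dissection.Cform (d : Dissection lG ipG ca) (e₁ e₂ e₃ : E) : A :=
  ipG (d.Rmap (d.toEquiv.symm e₁).2.2 (d.toEquiv.symm e₂).2.2) (d.toEquiv.symm e₃).2.1
  + ipG (d.Rmap (d.toEquiv.symm e₂).2.2 (d.toEquiv.symm e₃).2.2) (d.toEquiv.symm e₁).2.1
  + ipG (d.Rmap (d.toEquiv.symm e₃).2.2 (d.toEquiv.symm e₁).2.2) (d.toEquiv.symm e₂).2.1
  - ipG (lG (d.toEquiv.symm e₁).2.1 (d.toEquiv.symm e₂).2.1) (d.toEquiv.symm e₃).2.1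
  + d.Hmap (d.toEquiv.symm e₁).2.2 (d.toEquiv.symm e₂).2.2 (d.toEquiv.symm e₃).2.2

end Diss

namespace CourantAlgebroid

variable (ca : CourantAlgebroid A E)

lemma Dmap_mem_perp (f : A) : ca.Dmap f ∈ ca.perp := by
  intro k hk
  have h := ca.ip_D f k
  rw [LinearMap.mem_ker.1 hk, Derivation.zero_apply] at h
  have h2 : ((2 : ℝ)⁻¹ • ((2 : A) * ca.ip (ca.Dmap f) k)) = ca.ip (ca.Dmap f) k := by
    rw [two_mul, ← two_smul ℝ, smul_smul]
    norm_num
  rw [← h2, h, smul_zero]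

/-- The Courant and Dorfman brackets agree modulo `(ker ρ)⊥`. -/
lemma courantBk_eq (e₁ e₂ : E) :
    courantBk ca e₁ e₂ = ca.dorf e₁ e₂ - ca.Dmap (ca.ip e₁ e₂) := by
  have h : ca.dorf e₂ e₁ = (2 : ℝ) • ca.Dmap (ca.ip e₁ e₂) - ca.dorf e₁ e₂ := by
    rw [← ca.dorf_sym e₁ e₂, add_sub_cancel_left]
  rw [courantBk, h]
  module

lemma ip_dorf_swap_left (a b c : E) :
    ca.ip (ca.dorf a b) c = ca.rho c (ca.ip a b) - ca.ip (ca.dorf b a) c := by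
  have h := congrArg (fun e => ca.ip e c) (ca.dorf_sym a b)
  simp only [map_add, LinearMap.add_apply, two_smul] at h
  rw [← ca.ip_D (ca.ip a b) c]
  linear_combination h

lemma ip_dorf_swap_right (a b c : E) :
    ca.ip (ca.dorf a b) c = ca.rho a (ca.ip b c) - ca.ip (ca.dorf a c) b := by
  rw [ca.rho_ip a b c, ca.ip_symm b]
  ring

lemma ip_dorf_perp_right {k p : E} (a : E) (hk : ca.rho k = 0) (hp : p ∈ ca.perp) :
    ca.ip (ca.dorf a k) p = 0 := by
  rw [ca.ip_symm]
  exact hp _ (ca.dorf_ker_left_mem_ker a hk)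

lemma ip_dorf_perp_left {k p : E} (a : E) (hk : ca.rho k = 0) (hp : p ∈ ca.perp) :
    ca.ip (ca.dorf k a) p = 0 := by
  rw [ca.ip_symm]
  refine hp _ ?_
  rw [LinearMap.mem_ker, ca.rho_dorf, hk, zero_lie]

lemma dorf_perp_mem (a : E) {p : E} (hp : p ∈ ca.perp) : ca.dorf a p ∈ ca.perp := by
  intro k hk
  rw [ca.ip_dorf_swap_right, hp k hk, map_zero,
    ca.ip_dorf_perp_right a (LinearMap.mem_ker.1 hk) hp, sub_zero]

lemma perp_dorf_mem (a : E) {p : E} (hp : p ∈ ca.perp) : ca.dorf p a ∈ ca.perp := by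
  intro k hk
  rw [ca.ip_dorf_swap_left, LinearMap.mem_ker.1 hk, Derivation.zero_apply,
    ca.dorf_perp_mem a hp k hk, sub_zero]

end CourantAlgebroid

section Projections
variable {G : Type} [AddCommGroup G] [Module A G]
variable {lG : G →ₗ[A] G →ₗ[A] G} {ipG : G →ₗ[A] G →ₗ[A] A}
variable {ca : CourantAlgebroid A E} (d : Dissection lG ipG ca)

namespace Dissection

/-- The projection of `E` onto the image of `F` under a dissection. -/
def projF : E →ₗ[A] E where
  toFun e := d.toEquiv (0, 0, (d.toEquiv.symm e).2.2)
  map_add' a b := by rw [← map_add]; simp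
  map_smul' c a := by rw [RingHom.id_apply, ← map_smul]; simp

/-- The projection of `E` onto the image of `𝒢` under a dissection. -/
def projG : E →ₗ[A] E where
  toFun e := d.toEquiv (0, (d.toEquiv.symm e).2.1, 0)
  map_add' a b := by rw [← map_add]; simp
  map_smul' c a := by rw [RingHom.id_apply, ← map_smul]; simp

lemma projF_apply (e : E) : d.projF e = d.toEquiv (0, 0, (d.toEquiv.symm e).2.2) := rfl

lemma projG_apply (e : E) : d.projG e = d.toEquiv (0, (d.toEquiv.symm e).2.1, 0) := rfl

lemma rho_eq (e : E) : ca.rho e = (d.toEquiv.symm e).2.2 := by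
  rw [← d.anchor, LinearEquiv.apply_symm_apply]

lemma rho_projF (e : E) : ca.rho (d.projF e) = ca.rho e := by
  rw [projF_apply, d.anchor, d.rho_eq e]

lemma rho_projG (e : E) : ca.rho (d.projG e) = 0 := by
  rw [projG_apply, d.anchor]
  rfl

lemma projF_congr {e e' : E} (h : ca.rho e = ca.rho e') : d.projF e = d.projF e' := by
  rw [d.rho_eq e, d.rho_eq e'] at h
  rw [projF_apply, projF_apply, Subtype.ext h]

lemma ip_projF_projF (e e' : E) : ca.ip (d.projF e) (d.projF e') = 0 := by
  simp [projF_apply, d.metric]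

lemma ip_projF_projG (e e' : E) : ca.ip (d.projF e) (d.projG e') = 0 := by
  simp [projF_apply, projG_apply, d.metric]

lemma ip_projG_projF (e e' : E) : ca.ip (d.projG e) (d.projF e') = 0 := by
  rw [ca.ip_symm, ip_projF_projG]

lemma sub_proj_mem_perp (e : E) : e - d.projF e - d.projG e ∈ ca.perp := by
  have h : e - d.projF e - d.projG e = d.toEquiv ((d.toEquiv.symm e).1, 0, 0) := by
    rw [projF_apply, projG_apply]
    nth_rw 1 [← d.toEquiv.apply_symm_apply e]
    rw [← map_sub, ← map_sub]
    congr 1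
    ext <;> simp
  intro k hk
  rw [h, ← d.toEquiv.apply_symm_apply k, d.metric]
  have hk' : (d.toEquiv.symm k).2.2 = 0 := by
    rw [LinearMap.mem_ker, d.rho_eq] at hk
    exact Subtype.ext hk
  simp [hk']

lemma projG_eq_zero_of_mem_perp (ipG_nondeg : ∀ r, (∀ s, ipG r s = 0) → r = 0)
    {e : E} (he : e ∈ ca.perp) : d.projG e = 0 := by
  rw [projG_apply, ipG_nondeg (d.toEquiv.symm e).2.1]
  · exact map_zero _
  intro s
  have h := he (d.toEquiv (0, s, 0)) (by rw [LinearMap.mem_ker, d.anchor]; rfl)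
  rw [← d.toEquiv.apply_symm_apply e, d.metric] at h
  simpa using h

lemma projF_eq_zero_of_mem_perp {e : E} (he : e ∈ ca.perp) : d.projF e = 0 := by
  apply ca.ip_nondeg.1
  ext v
  rw [← d.toEquiv.apply_symm_apply v, projF_apply, d.metric]
  have h := he (d.toEquiv ((d.toEquiv.symm v).1, 0, 0))
    (by rw [LinearMap.mem_ker, d.anchor]; rfl)
  nth_rw 1 [← d.toEquiv.apply_symm_apply e] at h
  rw [d.metric] at h
  simpa using h

lemma rho_eq_zero_of_mem_perp (d : Dissection lG ipG ca) {e : E} (he : e ∈ ca.perp) : ca.rho e = 0 := by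
  rw [← d.rho_projF, d.projF_eq_zero_of_mem_perp he, map_zero]

lemma ip_projG_right (v e : E) :
    ca.ip v (d.projG e) = ipG (d.toEquiv.symm v).2.1 (d.toEquiv.symm e).2.1 := by
  nth_rw 1 [← d.toEquiv.apply_symm_apply v]
  rw [projG_apply, d.metric]
  simp

lemma two_mul_ip_projF_right (v e : E) :
    2 * ca.ip v (d.projF e) = (d.toEquiv.symm v).1 (d.toEquiv.symm e).2.2 := by
  nth_rw 1 [← d.toEquiv.apply_symm_apply v]
  rw [projF_apply, d.metric, two_mul, ← two_smul ℝ]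
  simp

/-- The naive 3-cocycle of a dissection in terms of the pseudo-metric and Dorfman bracket. -/
lemma Cform_eq (e₁ e₂ e₃ : E) :
    d.Cform e₁ e₂ e₃ =
      ca.ip (ca.dorf (d.projF e₁) (d.projF e₂)) (d.projG e₃)
      + ca.ip (ca.dorf (d.projF e₂) (d.projF e₃)) (d.projG e₁)
      + ca.ip (ca.dorf (d.projF e₃) (d.projF e₁)) (d.projG e₂)
      - ca.ip (ca.dorf (d.projG e₁) (d.projG e₂)) (d.projG e₃)
      + 2 * ca.ip (ca.dorf (d.projF e₁) (d.projF e₂)) (d.projF e₃) := by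
  simp only [ip_projG_right, two_mul_ip_projF_right, Cform, Rmap, Hmap]
  simp only [projF_apply, projG_apply, d.gbracket]

end Dissection

end Projections

namespace CourantAlgebroid

variable (ca : CourantAlgebroid A E)

lemma ip_dorf_perp_mid {k p : E} (a : E) (hk : ca.rho k = 0) (hp : p ∈ ca.perp) :
    ca.ip (ca.dorf a p) k = 0 :=
  ca.dorf_perp_mem a hp k hk

lemma ip_perp_dorf {k p : E} (a : E) (hk : ca.rho k = 0) (hp : p ∈ ca.perp) :
    ca.ip (ca.dorf p a) k = 0 :=
  ca.perp_dorf_mem a hp k hk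

lemma ip_dorf_ker_mid (l l' : E) {k : E} (hk : ca.rho k = 0) :
    ca.ip (ca.dorf l k) l' = ca.rho l (ca.ip k l') + ca.ip (ca.dorf l' l) k := by
  rw [ca.ip_dorf_swap_right l k l', ca.ip_dorf_swap_left l l' k, hk, Derivation.zero_apply]
  ring

lemma ip_dorf_ker_left (l l' k : E) :
    ca.ip (ca.dorf k l) l' =
      ca.rho l' (ca.ip k l) - ca.rho l (ca.ip k l') + ca.ip (ca.dorf l l') k := by
  rw [ca.ip_dorf_swap_left k l l', ca.ip_dorf_swap_right l k l']
  ring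

lemma ip_dorf_rotate {k k' : E} (hk : ca.rho k = 0) (hk' : ca.rho k' = 0) (l : E) :
    ca.ip (ca.dorf k k') l = ca.ip (ca.dorf l k) k' := by
  rw [ca.ip_dorf_swap_right k k' l, ca.ip_dorf_swap_left k l k', hk, hk',
    Derivation.zero_apply, Derivation.zero_apply]
  ring

/-- The Chern-Simons type identity comparing two splittings: `L`, `S` are the components of
three sections in the first splitting, `L + J + b` and `S - J` those in the second one. -/
lemma transgression {L₀ L₁ L₂ S₀ S₁ S₂ J₀ J₁ J₂ b₀ b₁ b₂ : E}
    (rS₀ : ca.rho S₀ = 0) (rS₁ : ca.rho S₁ = 0) (rS₂ : ca.rho S₂ = 0)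
    (rJ₀ : ca.rho J₀ = 0) (rJ₁ : ca.rho J₁ = 0) (rJ₂ : ca.rho J₂ = 0)
    (rb₀ : ca.rho b₀ = 0) (rb₁ : ca.rho b₁ = 0)
    (hb₀ : b₀ ∈ ca.perp) (hb₁ : b₁ ∈ ca.perp) (hb₂ : b₂ ∈ ca.perp)
    (LJ₁₀ : ca.ip L₁ J₀ = 0) (LJ₂₀ : ca.ip L₂ J₀ = 0) (LJ₂₁ : ca.ip L₂ J₁ = 0)
    (iso₀₁ : ca.ip b₀ L₁ = - ca.ip L₀ b₁ - ca.ip J₀ J₁)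
    (iso₁₂ : ca.ip b₁ L₂ = - ca.ip L₁ b₂ - ca.ip J₁ J₂) :
    (ca.ip (ca.dorf L₀ L₁) S₂ + ca.ip (ca.dorf L₁ L₂) S₀ + ca.ip (ca.dorf L₂ L₀) S₁
      - ca.ip (ca.dorf S₀ S₁) S₂ + 2 * ca.ip (ca.dorf L₀ L₁) L₂)
    - (ca.ip (ca.dorf (L₀ + J₀ + b₀) (L₁ + J₁ + b₁)) (S₂ - J₂)
      + ca.ip (ca.dorf (L₁ + J₁ + b₁) (L₂ + J₂ + b₂)) (S₀ - J₀)
      + ca.ip (ca.dorf (L₂ + J₂ + b₂) (L₀ + J₀ + b₀)) (S₁ - J₁)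
      - ca.ip (ca.dorf (S₀ - J₀) (S₁ - J₁)) (S₂ - J₂)
      + 2 * ca.ip (ca.dorf (L₀ + J₀ + b₀) (L₁ + J₁ + b₁)) (L₂ + J₂ + b₂))
    = ca.rho L₀ (2 * ca.ip L₁ b₂ + ca.ip J₁ J₂ + ca.ip S₁ J₂ - ca.ip J₁ S₂)
      + ca.rho L₁ (2 * ca.ip L₂ b₀ + ca.ip J₂ J₀ + ca.ip S₂ J₀ - ca.ip J₂ S₀)
      + ca.rho L₂ (2 * ca.ip L₀ b₁ + ca.ip J₀ J₁ + ca.ip S₀ J₁ - ca.ip J₀ S₁)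
      - (2 * ca.ip (ca.dorf L₀ L₁) b₂ + ca.ip (ca.dorf (L₀ + S₀) (L₁ + S₁)) J₂)
      - (2 * ca.ip (ca.dorf L₁ L₂) b₀ + ca.ip (ca.dorf (L₁ + S₁) (L₂ + S₂)) J₀)
      - (2 * ca.ip (ca.dorf L₂ L₀) b₁ + ca.ip (ca.dorf (L₂ + S₂) (L₀ + S₀)) J₁) := by
  simp only [map_add, map_sub, LinearMap.add_apply, LinearMap.sub_apply]
  simp only [ca.ip_dorf_rotate rJ₀ rJ₁ L₂, ca.ip_dorf_rotate rJ₀ rb₁ L₂,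
    ca.ip_dorf_rotate rb₀ rJ₁ L₂, ca.ip_dorf_rotate rb₀ rb₁ L₂]
  simp only [ca.ip_dorf_perp_right, ca.ip_dorf_perp_left, ca.ip_dorf_perp_mid,
    ca.ip_perp_dorf, rS₀, rS₁, rS₂, rJ₀, rJ₁, rJ₂, rb₀, rb₁, hb₀, hb₁, hb₂]
  simp only [ca.ip_dorf_ker_mid L₀ L₂ rJ₁, ca.ip_dorf_ker_mid L₀ L₂ rb₁,
    ca.ip_dorf_ker_left L₁ L₂ J₀, ca.ip_dorf_ker_left L₁ L₂ b₀]
  simp only [ca.ip_dorf_swap_left J₀ L₁, ca.ip_dorf_swap_left J₁ L₂, ca.ip_dorf_swap_left J₂ L₀,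
    ca.ip_dorf_swap_left S₀ L₁, ca.ip_dorf_swap_left S₁ L₂, ca.ip_dorf_swap_left S₂ L₀]
  simp only [ca.ip_dorf_swap_right L₁ J₀, ca.ip_dorf_swap_right L₂ J₁,
    ca.ip_dorf_swap_right L₀ J₂, ca.ip_dorf_swap_right L₁ S₀, ca.ip_dorf_swap_right L₂ S₁,
    ca.ip_dorf_swap_right L₀ S₂]
  simp only [ca.ip_dorf_rotate rJ₁ rJ₂ S₀, ca.ip_dorf_rotate rJ₁ rJ₂ J₀,
    ca.ip_dorf_rotate rS₁ rS₂ J₀, ca.ip_dorf_rotate rJ₂ rJ₀ S₁, ca.ip_dorf_rotate rJ₂ rJ₀ J₁,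
    ca.ip_dorf_rotate rS₂ rS₀ J₁, ca.ip_dorf_rotate rS₁ rJ₂ J₀,
    ca.ip_dorf_rotate rJ₁ rS₂ S₀]
  simp only [rS₀, rS₁, rS₂, rJ₀, rJ₁, rJ₂, Derivation.zero_apply, two_mul, map_add,
    ca.ip_symm J₀ L₁, ca.ip_symm J₀ L₂, ca.ip_symm J₁ L₂, LJ₁₀, LJ₂₀, LJ₂₁,
    iso₀₁, iso₁₂, map_sub, map_neg, map_zero, ca.ip_symm b₀ L₂, ca.ip_symm J₁ J₀,
    ca.ip_symm J₂ J₀, ca.ip_symm J₂ J₁, ca.ip_symm S₀ J₁, ca.ip_symm S₀ J₂, ca.ip_symm S₁ J₀,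
    ca.ip_symm S₁ J₂, ca.ip_symm S₂ J₀, ca.ip_symm S₂ J₁]
  ring

end CourantAlgebroid

section Comparison
variable {G : Type} [AddCommGroup G] [Module A G]
variable {lG : G →ₗ[A] G →ₗ[A] G} {ipG : G →ₗ[A] G →ₗ[A] A}
variable {ca : CourantAlgebroid A E} (d₁ d₂ : Dissection lG ipG ca)

namespace Dissection

/-- The `𝒢`-part, in the first dissection, of the difference of two splittings of the anchor. -/
def diffG : E →ₗ[A] E := d₁.projG ∘ₗ d₂.projF

/-- The `F*`-part, in the first dissection, of the difference of two splittings of the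
anchor. -/
def diffPerp : E →ₗ[A] E := d₂.projF - d₁.projF - diffG d₁ d₂

lemma projF_eq (e : E) : d₂.projF e = d₁.projF e + diffG d₁ d₂ e + diffPerp d₁ d₂ e := by
  simp only [diffPerp, LinearMap.sub_apply]
  abel

lemma rho_diffG (e : E) : ca.rho (diffG d₁ d₂ e) = 0 := d₁.rho_projG _

lemma ip_projF_diffG (e e' : E) : ca.ip (d₁.projF e) (diffG d₁ d₂ e') = 0 :=
  d₁.ip_projF_projG _ _

lemma diffPerp_mem (e : E) : diffPerp d₁ d₂ e ∈ ca.perp := by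
  have h := d₁.sub_proj_mem_perp (d₂.projF e)
  rwa [d₁.projF_congr (d₂.rho_projF e)] at h

lemma rho_diffPerp (e : E) : ca.rho (diffPerp d₁ d₂ e) = 0 :=
  d₁.rho_eq_zero_of_mem_perp (diffPerp_mem d₁ d₂ e)

lemma ip_diffPerp_left (e : E) {k : E} (hk : ca.rho k = 0) : ca.ip (diffPerp d₁ d₂ e) k = 0 :=
  diffPerp_mem d₁ d₂ e k hk

lemma ip_diffPerp_right (e : E) {k : E} (hk : ca.rho k = 0) :
    ca.ip k (diffPerp d₁ d₂ e) = 0 := by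
  rw [ca.ip_symm, ip_diffPerp_left d₁ d₂ e hk]

/-- The components along `𝒢` for two dissections agree modulo `(ker ρ)⊥`, up to `diffG`. -/
lemma projG_sub_mem (e : E) :
    d₂.projG e - (d₁.projG e - diffG d₁ d₂ e) ∈ ca.perp := by
  have h := ca.perp.sub_mem (ca.perp.sub_mem (d₁.sub_proj_mem_perp e)
    (d₂.sub_proj_mem_perp e)) (diffPerp_mem d₁ d₂ e)
  rw [projF_eq d₁ d₂ e] at h
  convert h using 1
  abel

lemma ip_projG_left_eq (e : E) {k : E} (hk : ca.rho k = 0) :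
    ca.ip (d₂.projG e) k = ca.ip (d₁.projG e - diffG d₁ d₂ e) k := by
  have h := projG_sub_mem d₁ d₂ e k hk
  rwa [map_sub, LinearMap.sub_apply, sub_eq_zero] at h

lemma ip_projG_right_eq (e : E) {k : E} (hk : ca.rho k = 0) :
    ca.ip k (d₂.projG e) = ca.ip k (d₁.projG e - diffG d₁ d₂ e) := by
  rw [ca.ip_symm, ip_projG_left_eq d₁ d₂ e hk, ca.ip_symm]

/-- Isotropy of the second splitting of the anchor, in terms of the first one. -/
lemma ip_diffPerp_projF (e e' : E) :
    ca.ip (diffPerp d₁ d₂ e) (d₁.projF e') =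
      - ca.ip (d₁.projF e) (diffPerp d₁ d₂ e') - ca.ip (diffG d₁ d₂ e) (diffG d₁ d₂ e') := by
  have h := d₂.ip_projF_projF e e'
  simp only [projF_eq d₁ d₂, map_add, LinearMap.add_apply, d₁.ip_projF_projF,
    ip_projF_diffG, ca.ip_symm (diffG d₁ d₂ e) (d₁.projF e'),
    ip_diffPerp_left d₁ d₂ e (rho_diffG d₁ d₂ e'),
    ip_diffPerp_left d₁ d₂ e (rho_diffPerp d₁ d₂ e'),
    ip_diffPerp_right d₁ d₂ e' (rho_diffG d₁ d₂ e)] at h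
  linear_combination h

/-- The naive 2-cochain relating the 3-cocycles of two dissections. -/
def cochain (e e' : E) : A :=
  ca.ip (d₁.projF e) (d₂.projF e') - ca.ip (d₂.projF e) (d₁.projF e')
    - (ca.ip (d₁.projG e) (d₂.projG e') - ca.ip (d₂.projG e) (d₁.projG e'))

lemma cochain_skew (e e' : E) : cochain d₁ d₂ e e' = - cochain d₁ d₂ e' e := by
  simp only [cochain]
  rw [ca.ip_symm (d₁.projF e), ca.ip_symm (d₂.projF e), ca.ip_symm (d₁.projG e),
    ca.ip_symm (d₂.projG e)]
  ring

lemma cochain_linear (f : A) (e₁ e₁' e₂ : E) :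
    cochain d₁ d₂ (f • e₁ + e₁') e₂ = f * cochain d₁ d₂ e₁ e₂ + cochain d₁ d₂ e₁' e₂ := by
  simp only [cochain, map_add, map_smul, LinearMap.add_apply, LinearMap.smul_apply, smul_eq_mul]
  ring

lemma cochain_perp (ipG_nondeg : ∀ r, (∀ s, ipG r s = 0) → r = 0) {e : E}
    (he : e ∈ ca.perp) (e' : E) : cochain d₁ d₂ e e' = 0 := by
  simp [cochain, projF_eq_zero_of_mem_perp _ he, projG_eq_zero_of_mem_perp _ ipG_nondeg he]

lemma cochain_courantBk (ipG_nondeg : ∀ r, (∀ s, ipG r s = 0) → r = 0) (e₁ e₂ e : E) :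
    cochain d₁ d₂ (courantBk ca e₁ e₂) e = cochain d₁ d₂ (ca.dorf e₁ e₂) e := by
  have h := cochain_linear d₁ d₂ (-1) (ca.Dmap (ca.ip e₁ e₂)) (ca.dorf e₁ e₂) e
  rw [cochain_perp d₁ d₂ ipG_nondeg (ca.Dmap_mem_perp _), mul_zero, zero_add] at h
  rw [← h, ca.courantBk_eq, neg_one_smul, sub_eq_neg_add]

lemma cochain_dorf_swap (ipG_nondeg : ∀ r, (∀ s, ipG r s = 0) → r = 0) (e₁ e₂ e : E) :
    cochain d₁ d₂ (ca.dorf e₁ e₂) e = - cochain d₁ d₂ (ca.dorf e₂ e₁) e := by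
  have hp : (2 : ℝ) • ca.Dmap (ca.ip e₁ e₂) ∈ ca.perp := by
    rw [two_smul]
    exact ca.perp.add_mem (ca.Dmap_mem_perp _) (ca.Dmap_mem_perp _)
  rw [← ca.dorf_sym] at hp
  have h := cochain_linear d₁ d₂ 1 (ca.dorf e₁ e₂) (ca.dorf e₂ e₁) e
  rw [one_smul, cochain_perp d₁ d₂ ipG_nondeg hp] at h
  linear_combination -h

lemma cochain_eq (e e' : E) :
    cochain d₁ d₂ e e' =
      2 * ca.ip (d₁.projF e) (diffPerp d₁ d₂ e') + ca.ip (diffG d₁ d₂ e) (diffG d₁ d₂ e')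
        + ca.ip (d₁.projG e) (diffG d₁ d₂ e') - ca.ip (diffG d₁ d₂ e) (d₁.projG e') := by
  simp only [cochain, ip_projG_right_eq d₁ d₂ e' (d₁.rho_projG e),
    ip_projG_left_eq d₁ d₂ e (d₁.rho_projG e')]
  simp only [projF_eq d₁ d₂, map_add, map_sub, LinearMap.add_apply, LinearMap.sub_apply,
    d₁.ip_projF_projF, ip_projF_diffG, ca.ip_symm (diffG d₁ d₂ e) (d₁.projF e'),
    ip_diffPerp_projF]
  ring

/-- The `F`-component of a bracket agrees with the bracket of lifts up to `ker ρ`. -/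
lemma ip_projF_dorf {p : E} (hp : p ∈ ca.perp) {a a' e e' : E} (h : ca.rho a = ca.rho e)
    (h' : ca.rho a' = ca.rho e') :
    ca.ip (d₁.projF (ca.dorf e e')) p = ca.ip (ca.dorf a a') p := by
  have hk : ca.rho (d₁.projF (ca.dorf e e') - ca.dorf a a') = 0 := by
    rw [map_sub, d₁.rho_projF, ca.rho_dorf, ca.rho_dorf, h, h', sub_self]
  have h0 := hp _ (LinearMap.mem_ker.2 hk)
  rw [ca.ip_symm, map_sub, LinearMap.sub_apply, sub_eq_zero] at h0
  exact h0

/-- The `𝒢`-component of a bracket, paired with the image of `𝒢`. -/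
lemma ip_projG_dorf (e e' v : E) :
    ca.ip (d₁.projG (ca.dorf e e')) (d₁.projG v) =
      ca.ip (ca.dorf (d₁.projF e + d₁.projG e) (d₁.projF e' + d₁.projG e')) (d₁.projG v) := by
  have h1 := d₁.sub_proj_mem_perp (ca.dorf e e') _ (d₁.rho_projG v)
  have h2 := ca.perp_dorf_mem e' (d₁.sub_proj_mem_perp e) _ (d₁.rho_projG v)
  have h3 := ca.dorf_perp_mem (d₁.projF e + d₁.projG e) (d₁.sub_proj_mem_perp e') _
    (d₁.rho_projG v)
  simp only [map_add, map_sub, LinearMap.add_apply, LinearMap.sub_apply,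
    d₁.ip_projF_projG] at h1 h2 h3 ⊢
  linear_combination -h1 + h2 + h3

lemma cochain_dorf (e e' v : E) :
    cochain d₁ d₂ (ca.dorf e e') v =
      2 * ca.ip (ca.dorf (d₁.projF e) (d₁.projF e')) (diffPerp d₁ d₂ v)
        + ca.ip (ca.dorf (d₁.projF e + d₁.projG e) (d₁.projF e' + d₁.projG e'))
          (diffG d₁ d₂ v)
        - ca.ip (diffG d₁ d₂ (ca.dorf e e')) (d₁.projG v - diffG d₁ d₂ v) := by
  rw [cochain_eq, ip_projF_dorf d₁ (diffPerp_mem d₁ d₂ v) (d₁.rho_projF e) (d₁.rho_projF e'),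
    show diffG d₁ d₂ v = d₁.projG (d₂.projF v) from rfl, ip_projG_dorf, map_sub]
  ring

/-- The curvature term of the second dissection in terms of the first one. -/
lemma ip_dorf_projF_projG (e e' v : E) :
    ca.ip (ca.dorf (d₂.projF e) (d₂.projF e')) (d₂.projG v) =
      ca.ip (ca.dorf (d₂.projF e) (d₂.projF e')) (d₁.projG v - diffG d₁ d₂ v)
        - ca.ip (diffG d₁ d₂ (ca.dorf e e')) (d₁.projG v - diffG d₁ d₂ v) := by
  have h1 := ip_projF_dorf d₁ (projG_sub_mem d₁ d₂ v) (d₂.rho_projF e) (d₂.rho_projF e')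
  have h2 := d₂.ip_projF_projG (ca.dorf e e') v
  rw [projF_eq d₁ d₂, map_add, map_add, LinearMap.add_apply, LinearMap.add_apply,
    ip_diffPerp_left d₁ d₂ _ (d₂.rho_projG v),
    ip_projG_right_eq d₁ d₂ v (rho_diffG d₁ d₂ _)] at h2
  simp only [map_sub, d₁.ip_projF_projG, ip_projF_diffG] at h1 h2 ⊢
  linear_combination -h1 + h2

lemma ip_dorf_projG_projG (e e' v : E) :
    ca.ip (ca.dorf (d₂.projG e) (d₂.projG e')) (d₂.projG v) =
      ca.ip (ca.dorf (d₁.projG e - diffG d₁ d₂ e) (d₁.projG e' - diffG d₁ d₂ e'))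
        (d₁.projG v - diffG d₁ d₂ v) := by
  have hv : ca.rho (d₁.projG v - diffG d₁ d₂ v) = 0 := by
    rw [map_sub, d₁.rho_projG, rho_diffG, sub_zero]
  rw [ip_projG_right_eq d₁ d₂ v (ca.dorf_mem_ker (d₂.rho_projG e) (d₂.rho_projG e'))]
  have h2 := ca.perp_dorf_mem (d₂.projG e') (projG_sub_mem d₁ d₂ e) _ hv
  have h3 := ca.dorf_perp_mem (d₁.projG e - diffG d₁ d₂ e) (projG_sub_mem d₁ d₂ e') _ hv
  simp only [map_sub, LinearMap.sub_apply] at h2 h3 ⊢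
  linear_combination h2 + h3

/-- The 3-cocycles of two dissections differ by the coboundary of `cochain`. -/
lemma Cform_sub_Cform (ipG_nondeg : ∀ r, (∀ s, ipG r s = 0) → r = 0) (e₀ e₁ e₂ : E) :
    d₁.Cform e₀ e₁ e₂ - d₂.Cform e₀ e₁ e₂ =
      dCE2 (fun e f => ca.rho e f) (courantBk ca) (cochain d₁ d₂) e₀ e₁ e₂ := by
  have key := ca.transgression (d₁.rho_projG e₀) (d₁.rho_projG e₁) (d₁.rho_projG e₂)
    (rho_diffG d₁ d₂ e₀) (rho_diffG d₁ d₂ e₁) (rho_diffG d₁ d₂ e₂)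
    (rho_diffPerp d₁ d₂ e₀) (rho_diffPerp d₁ d₂ e₁)
    (diffPerp_mem d₁ d₂ e₀) (diffPerp_mem d₁ d₂ e₁) (diffPerp_mem d₁ d₂ e₂)
    (ip_projF_diffG d₁ d₂ e₁ e₀) (ip_projF_diffG d₁ d₂ e₂ e₀) (ip_projF_diffG d₁ d₂ e₂ e₁)
    (ip_diffPerp_projF d₁ d₂ e₀ e₁) (ip_diffPerp_projF d₁ d₂ e₁ e₂)
  simp only [← projF_eq, ← cochain_eq, d₁.rho_projF] at key
  rw [dCE2, cochain_courantBk d₁ d₂ ipG_nondeg, cochain_courantBk d₁ d₂ ipG_nondeg,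
    cochain_courantBk d₁ d₂ ipG_nondeg, cochain_dorf_swap d₁ d₂ ipG_nondeg e₀ e₂,
    cochain_skew d₁ d₂ e₀ e₂, cochain_dorf, cochain_dorf, cochain_dorf, Cform_eq, Cform_eq,
    ip_dorf_projG_projG d₁ d₂, ip_dorf_projF_projG d₁ d₂, ip_dorf_projF_projG d₁ d₂,
    ip_dorf_projF_projG d₁ d₂, map_neg]
  linear_combination key

end Dissection

end Comparison

open CourantAlgebroid in
/-- The naive 3-cocycles associated to two dissections of a regular
Courant algebroid differ by the naive coboundary `d̆φ` of a naive 2-cochain `φ`;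
consequently the characteristic class `[C_Ψ] ∈ H³_naive(E)` is independent of `Ψ`. -/
theorem statement5
    {A : Type} [CommRing A] [Algebra ℝ A]
    {E : Type} [AddCommGroup E] [Module A E] [Module ℝ E] [IsScalarTower ℝ A E]
    {G : Type} [AddCommGroup G] [Module A G] [Module ℝ G] [IsScalarTower ℝ A G]
    -- 𝒢 is a bundle of quadratic Lie algebras
    (lG : G →ₗ[A] G →ₗ[A] G) (ipG : G →ₗ[A] G →ₗ[A] A)
    (lG_skew : ∀ r s, lG r s = - lG s r)
    (lG_jacobi : ∀ r s t, lG r (lG s t) = lG (lG r s) t + lG s (lG r t))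
    (ipG_symm : ∀ r s, ipG r s = ipG s r)
    (ipG_nondeg : ∀ r, (∀ s, ipG r s = 0) → r = 0)
    (ipG_ad : ∀ r s t, ipG (lG r s) t + ipG s (lG r t) = 0)
    (ca : CourantAlgebroid A E) (hreg : ca.IsRegular)
    (d₁ d₂ : Dissection lG ipG ca) :
    ∃ φ : E → E → A,
      -- φ is a naive 2-cochain: alternating, C^∞(M)-bilinear, a section of ∧²ker ρ
      (∀ e₁ e₂, φ e₁ e₂ = - φ e₂ e₁) ∧
      (∀ (f : A) e₁ e₁' e₂, φ (f • e₁ + e₁') e₂ = f * φ e₁ e₂ + φ e₁' e₂) ∧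
      (∀ e₁ e₂, e₁ ∈ ca.perp → φ e₁ e₂ = 0) ∧
      -- C_{Ψ₁} − C_{Ψ₂} = d̆φ
      (∀ e₀ e₁ e₂,
        d₁.Cform e₀ e₁ e₂ - d₂.Cform e₀ e₁ e₂
          = dCE2 (fun e f => ca.rho e f) (courantBk ca) φ e₀ e₁ e₂) := by
  exact ⟨d₁.cochain d₂, d₁.cochain_skew d₂, d₁.cochain_linear d₂,
    fun _ e₂ he => d₁.cochain_perp d₂ ipG_nondeg he e₂,
    d₁.Cform_sub_Cform d₂ ipG_nondeg⟩
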